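/- For all integers n ≥ b ≥ 2, the number of (n,b)-domino towers T satisfying the additional condition that every level-1 domino lies strictly to the right of the left edge of the base (i.e., every (x,1) ∈ T has x ≥ 1) equals C(2n−3, n−b). -/

import Mathlib

/-- `T` is an (n,b)-domino tower: a finite set of pairs `(x, y)` where `(x, y) ∈ T` means a
horizontal 1×2 domino occupies columns `x` and `x+1` at level `y`. -/
def IsDominoTower (n b : ℕ) (T : Finset (ℤ × ℕ)) : Prop :=
  T.card = n ∧
  (∀ x : ℤ, (x, 0) ∈ T ↔ ∃ i : ℕ, i < b ∧ x = 2 * (i : ℤ)) ∧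
  (∀ x x' : ℤ, ∀ y : ℕ, (x, y) ∈ T → (x', y) ∈ T → x ≠ x' → 2 ≤ |x - x'|) ∧
  (∀ x : ℤ, ∀ y : ℕ, (x, y + 1) ∈ T → ∃ x' : ℤ, (x', y) ∈ T ∧ |x - x'| ≤ 1)

namespace DT

/-- positions in conflict with a position of `R` -/
noncomputable def N (R : Finset ℤ) : Finset ℤ := R.biUnion (fun x => Finset.Icc (x - 1) (x + 1))

lemma mem_N {R : Finset ℤ} {x : ℤ} : x ∈ N R ↔ ∃ x' ∈ R, |x - x'| ≤ 1 := by
  simp only [N, Finset.mem_biUnion, Finset.mem_Icc]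
  refine exists_congr fun a => and_congr_right fun _ => ?_
  rw [abs_le]
  constructor <;> rintro ⟨h1, h2⟩ <;> constructor <;> linarith

def Ind (R : Finset ℤ) : Prop := ∀ x ∈ R, ∀ x' ∈ R, x ≠ x' → 2 ≤ |x - x'|

def Good (T : Finset (ℤ × ℕ)) : Prop :=
  (∀ x x' : ℤ, ∀ y : ℕ, (x, y) ∈ T → (x', y) ∈ T → x ≠ x' → 2 ≤ |x - x'|) ∧
  (∀ x : ℤ, ∀ y : ℕ, (x, y + 1) ∈ T → ∃ x' : ℤ, (x', y) ∈ T ∧ |x - x'| ≤ 1)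

def Tw (M : Finset ℤ) (k : ℕ) (T : Finset (ℤ × ℕ)) : Prop :=
  T.card = k ∧ (∀ x : ℤ, (x, 0) ∈ T → x ∈ M) ∧ Good T

def e0 : ℤ ↪ ℤ × ℕ := ⟨fun x => (x, 0), fun a b h => by simpa using h⟩
def e1 : ℤ × ℕ ↪ ℤ × ℕ := ⟨fun p => (p.1, p.2 + 1), fun a b h => by
  simp only [Prod.mk.injEq, add_left_inj] at h
  exact Prod.ext h.1 h.2⟩

lemma e0_apply (x : ℤ) : e0 x = (x, 0) := rfl
lemma e1_apply (p : ℤ × ℕ) : e1 p = (p.1, p.2 + 1) := rfl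

def cons (R : Finset ℤ) (T : Finset (ℤ × ℕ)) : Finset (ℤ × ℕ) := R.map e0 ∪ T.map e1
noncomputable def row (T : Finset (ℤ × ℕ)) : Finset ℤ := T.preimage e0 e0.injective.injOn
noncomputable def up (T : Finset (ℤ × ℕ)) : Finset (ℤ × ℕ) := T.preimage e1 e1.injective.injOn

lemma mem_row {T : Finset (ℤ × ℕ)} {x : ℤ} : x ∈ row T ↔ (x, 0) ∈ T := by
  simp [row, e0_apply]
lemma mem_up {T : Finset (ℤ × ℕ)} {x : ℤ} {y : ℕ} : (x, y) ∈ up T ↔ (x, y + 1) ∈ T := by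
  simp [up, e1_apply]
lemma mem_cons0 {R : Finset ℤ} {T : Finset (ℤ × ℕ)} {x : ℤ} : (x, 0) ∈ cons R T ↔ x ∈ R := by
  simp [cons, e0_apply, e1_apply]
lemma mem_cons1 {R : Finset ℤ} {T : Finset (ℤ × ℕ)} {x : ℤ} {y : ℕ} :
    (x, y + 1) ∈ cons R T ↔ (x, y) ∈ T := by
  simp [cons, e0_apply, e1_apply]

lemma card_cons (R : Finset ℤ) (T : Finset (ℤ × ℕ)) : (cons R T).card = R.card + T.card := by
  rw [cons, Finset.card_union_of_disjoint, Finset.card_map, Finset.card_map]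
  rw [Finset.disjoint_left]
  rintro ⟨x, y⟩ h1 h2
  cases y with
  | zero => simp [e1_apply] at h2
  | succ y => simp [e0_apply] at h1

lemma cons_row_up (T : Finset (ℤ × ℕ)) : cons (row T) (up T) = T := by
  ext ⟨x, y⟩
  cases y with
  | zero => rw [mem_cons0, mem_row]
  | succ y => rw [mem_cons1, mem_up]

lemma row_cons (R : Finset ℤ) (T : Finset (ℤ × ℕ)) : row (cons R T) = R := by
  ext x; rw [mem_row, mem_cons0]

lemma up_cons (R : Finset ℤ) (T : Finset (ℤ × ℕ)) : up (cons R T) = T := by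
  ext ⟨x, y⟩; rw [mem_up, mem_cons1]

lemma good_cons (R : Finset ℤ) (T : Finset (ℤ × ℕ)) :
    Good (cons R T) ↔ Ind R ∧ (∀ x : ℤ, (x, 0) ∈ T → x ∈ N R) ∧ Good T := by
  constructor
  · rintro ⟨h1, h2⟩
    refine ⟨fun x hx x' hx' => h1 x x' 0 (mem_cons0.2 hx) (mem_cons0.2 hx'), ?_, ?_, ?_⟩
    · intro x hx
      obtain ⟨x', hx', h⟩ := h2 x 0 (mem_cons1.2 hx)
      exact mem_N.2 ⟨x', mem_cons0.1 hx', h⟩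
    · intro x x' y hx hx'
      exact h1 x x' (y + 1) (mem_cons1.2 hx) (mem_cons1.2 hx')
    · intro x y hx
      obtain ⟨x', hx', h⟩ := h2 x (y + 1) (mem_cons1.2 hx)
      exact ⟨x', mem_cons1.1 hx', h⟩
  · rintro ⟨hR, hN, h1, h2⟩
    constructor
    · intro x x' y hx hx'
      cases y with
      | zero => exact hR x (mem_cons0.1 hx) x' (mem_cons0.1 hx')
      | succ y => exact h1 x x' y (mem_cons1.1 hx) (mem_cons1.1 hx')
    · intro x y hx
      have hx := mem_cons1.1 hx
      cases y with
      | zero =>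
        obtain ⟨x', hx', h⟩ := mem_N.1 (hN x hx)
        exact ⟨x', mem_cons0.2 hx', h⟩
      | succ y =>
        obtain ⟨x', hx', h⟩ := h2 x y hx
        exact ⟨x', mem_cons1.2 hx', h⟩

open Classical in
/-- admissible first rows -/
noncomputable def Rows (M : Finset ℤ) (k : ℕ) : Finset (Finset ℤ) :=
  M.powerset.filter (fun R => Ind R ∧ R.card ≤ k)

lemma mem_Rows {M : Finset ℤ} {k : ℕ} {R : Finset ℤ} :
    R ∈ Rows M k ↔ R ⊆ M ∧ Ind R ∧ R.card ≤ k := by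
  simp [Rows]

lemma tw_row {M : Finset ℤ} {k : ℕ} {T : Finset (ℤ × ℕ)} (h : Tw M k T) : row T ∈ Rows M k := by
  obtain ⟨h1, h2, h3⟩ := h
  have hc := card_cons (row T) (up T)
  rw [cons_row_up] at hc
  rw [← cons_row_up T, good_cons] at h3
  exact mem_Rows.2 ⟨fun x hx => h2 x (mem_row.1 hx), h3.1, by omega⟩

lemma tw_up {M : Finset ℤ} {k : ℕ} {T : Finset (ℤ × ℕ)} (h : Tw M k T) :
    Tw (N (row T)) (k - (row T).card) (up T) := by
  obtain ⟨h1, h2, h3⟩ := h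
  have hc := card_cons (row T) (up T)
  rw [cons_row_up] at hc
  rw [← cons_row_up T, good_cons] at h3
  exact ⟨by omega, h3.2.1, h3.2.2⟩

lemma tw_cons {M : Finset ℤ} {k : ℕ} {R : Finset ℤ} {T : Finset (ℤ × ℕ)} (hR : R ∈ Rows M k)
    (h : Tw (N R) (k - R.card) T) : Tw M k (cons R T) := by
  obtain ⟨h1, h2, h3⟩ := h
  obtain ⟨r1, r2, r3⟩ := mem_Rows.1 hR
  refine ⟨?_, fun x hx => r1 (mem_cons0.1 hx), (good_cons _ _).2 ⟨r2, h2, h3⟩⟩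
  rw [card_cons]; omega

noncomputable def twEquiv (M : Finset ℤ) (k : ℕ) : {T // Tw M k T} ≃
    Σ R : {R // R ∈ Rows M k}, {T // Tw (N R.1) (k - R.1.card) T} where
  toFun T := ⟨⟨row T.1, tw_row T.2⟩, ⟨up T.1, tw_up T.2⟩⟩
  invFun p := ⟨cons p.1.1 p.2.1, tw_cons p.1.2 p.2.2⟩
  left_inv T := Subtype.ext (cons_row_up T.1)
  right_inv := by
    rintro ⟨⟨R, hR⟩, ⟨T, hT⟩⟩
    have h1 := row_cons R T
    have h2 := up_cons R T
    simp only [Sigma.mk.injEq, Subtype.mk.injEq]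
    refine ⟨h1, ?_⟩
    refine (Subtype.heq_iff_coe_eq ?_).2 h2
    intro x
    simp only [h1]

lemma tw_empty {k : ℕ} {T : Finset (ℤ × ℕ)} (h : Tw ∅ k T) : T = ∅ := by
  obtain ⟨-, h0, -, h2⟩ := h
  have key : ∀ y : ℕ, ∀ x : ℤ, (x, y) ∉ T := by
    intro y
    induction y with
    | zero => intro x hx; simpa using h0 x hx
    | succ y ih =>
      intro x hx
      obtain ⟨x', hx', -⟩ := h2 x y hx
      exact ih x' hx'
  ext ⟨x, y⟩
  simp [key y x]

lemma finite_tw (k : ℕ) : ∀ M, Finite {T // Tw M k T} := by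
  induction k using Nat.strong_induction_on with
  | _ k ih =>
    intro M
    have : ∀ R : {R // R ∈ Rows M k}, Finite {T // Tw (N R.1) (k - R.1.card) T} := by
      rintro ⟨R, hR⟩
      rcases R.eq_empty_or_nonempty with rfl | hne
      · have hN : N ∅ = ∅ := by simp [N]
        simp only [hN]
        have : Subsingleton {T // Tw ∅ (k - (∅ : Finset ℤ).card) T} :=
          ⟨fun a b => Subtype.ext ((tw_empty a.2).trans (tw_empty b.2).symm)⟩
        infer_instance
      · have := hne.card_pos
        have h2 := (mem_Rows.1 hR).2.2
        exact ih _ (by dsimp only; omega) _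
    exact Finite.of_equiv _ (twEquiv M k).symm

noncomputable def g (M : Finset ℤ) (k : ℕ) : ℕ := Nat.card {T // Tw M k T}

open Classical in
noncomputable def B (A C : Finset ℤ) (k : ℕ) : ℕ :=
  ∑ R ∈ C.powerset, if Ind R ∧ R.card ≤ k then g (A ∪ N R) (k - R.card) else 0

lemma g_eq_B (M : Finset ℤ) (k : ℕ) : g M k = B ∅ M k := by
  classical
  have : ∀ R : {R // R ∈ Rows M k}, Finite {T // Tw (N R.1) (k - R.1.card) T} :=
    fun R => finite_tw _ _
  rw [g, Nat.card_congr (twEquiv M k), Nat.card_sigma, B, ← Finset.sum_filter]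
  simp only [Finset.empty_union]
  exact Finset.sum_coe_sort (Rows M k) (fun R => g (N R) (k - R.card))

lemma g_zero (M : Finset ℤ) : g M 0 = 1 := by
  rw [g, Nat.card_eq_one_iff_unique]
  refine ⟨⟨fun a b => Subtype.ext ?_⟩, ⟨⟨∅, by simp [Tw, Good]⟩⟩⟩
  rw [Finset.card_eq_zero.1 a.2.1, Finset.card_eq_zero.1 b.2.1]

lemma g_empty (k : ℕ) : g ∅ (k + 1) = 0 := by
  rw [g]
  have : IsEmpty {T // Tw ∅ (k + 1) T} := ⟨fun a => by
    have h := a.2.1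
    rw [tw_empty a.2] at h
    simp at h⟩
  exact Nat.card_of_isEmpty

lemma N_insert (c : ℤ) (R : Finset ℤ) : N (insert c R) = N {c} ∪ N R := by
  simp [N]

lemma ind_insert {c : ℤ} {R : Finset ℤ} (hc : c ∉ R) :
    Ind (insert c R) ↔ Ind R ∧ Disjoint R (N {c}) := by
  have hN : ∀ x, x ∈ N {c} ↔ |x - c| ≤ 1 := by intro x; simp [mem_N]
  simp only [Finset.disjoint_left, hN, not_le]
  constructor
  · intro h
    refine ⟨fun x hx x' hx' => h x (by simp [hx]) x' (by simp [hx']), fun x hx => ?_⟩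
    have := h x (by simp [hx]) c (by simp) (by rintro rfl; exact hc hx)
    omega
  · rintro ⟨h1, h2⟩ x hx x' hx' hne
    rcases Finset.mem_insert.1 hx with rfl | hx
    · rcases Finset.mem_insert.1 hx' with rfl | hx'
      · exact absurd rfl hne
      · have := h2 hx'
        rw [abs_sub_comm]; omega
    · rcases Finset.mem_insert.1 hx' with h3 | hx'
      · rw [h3]
        have := h2 hx
        omega
      · exact h1 x hx x' hx' hne

lemma self_mem_N (c : ℤ) : c ∈ N {c} := by simp [mem_N]

lemma B_split (A C : Finset ℤ) (k : ℕ) (c : ℤ) (hc : c ∈ C) :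
    B A C (k + 1) = B A (C.erase c) (k + 1) + B (A ∪ N {c}) (C \ N {c}) k := by
  classical
  have h0 : c ∉ C.erase c := by simp
  conv_lhs => rw [B, ← Finset.insert_erase hc, Finset.sum_powerset_insert h0]
  rw [B, B]
  congr 1
  have hsub : (C \ N {c}).powerset ⊆ (C.erase c).powerset := by
    rw [Finset.powerset_mono]
    intro x hx
    rw [Finset.mem_sdiff] at hx
    refine Finset.mem_erase.2 ⟨?_, hx.1⟩
    rintro rfl
    exact hx.2 (self_mem_N _)
  symm
  rw [← Finset.sum_subset hsub]
  · refine Finset.sum_congr rfl fun R hR => ?_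
    have hR' := Finset.mem_powerset.1 hR
    have hcR : c ∉ R := fun h => (Finset.mem_sdiff.1 (hR' h)).2 (self_mem_N c)
    have hd : Disjoint R (N {c}) :=
      Finset.disjoint_left.2 fun x hx => (Finset.mem_sdiff.1 (hR' hx)).2
    rw [ind_insert hcR, Finset.card_insert_of_notMem hcR, N_insert, Finset.union_assoc]
    simp [hd]
  · intro R hR hR'
    have hR1 := Finset.mem_powerset.1 hR
    have hcR : c ∉ R := fun h => h0 (hR1 h)
    rw [if_neg]
    rw [ind_insert hcR]
    rintro ⟨⟨-, hd⟩, -⟩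
    apply hR'
    rw [Finset.mem_powerset]
    intro x hx
    exact Finset.mem_sdiff.2 ⟨Finset.mem_of_mem_erase (hR1 hx), Finset.disjoint_left.1 hd hx⟩

lemma B_zero (A C : Finset ℤ) : B A C 0 = 1 := by
  classical
  rw [B, Finset.sum_eq_single ∅]
  · simp [Ind, g_zero]
  · intro R _ hne
    rw [if_neg]
    rintro ⟨-, h⟩
    exact hne (by simpa using h)
  · simp

lemma B_empty (A : Finset ℤ) (k : ℕ) : B A ∅ k = g A k := by
  simp [B, Ind, N]

lemma star_of (k : ℕ) (h : ∀ A C, Disjoint A C → B A C k = g (A ∪ C) k)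
    (M : Finset ℤ) (c : ℤ) (hc : c ∈ M) :
    g M (k + 1) = g (M.erase c) (k + 1) + g (M ∪ N {c}) k := by
  rw [g_eq_B M, B_split _ _ _ c hc, ← g_eq_B, Finset.empty_union,
    h _ _ Finset.disjoint_sdiff, Finset.union_sdiff_self_eq_union, Finset.union_comm]

lemma B_eq (k : ℕ) : ∀ A C, Disjoint A C → B A C k = g (A ∪ C) k := by
  induction k with
  | zero => intro A C _; rw [B_zero, g_zero]
  | succ k ih =>
    intro A C
    induction C using Finset.induction_on with
    | empty => intro _; rw [B_empty, Finset.union_empty]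
    | insert c C hc ihC =>
      intro hd
      rw [Finset.disjoint_insert_right] at hd
      rw [B_split _ _ _ c (Finset.mem_insert_self _ _), Finset.erase_insert hc, ihC hd.2,
        star_of k ih (A ∪ insert c C) c (by simp), ih]
      · congr 2
        · ext x
          simp only [Finset.mem_union, Finset.mem_erase, Finset.mem_insert]
          constructor
          · rintro (h | h)
            · exact ⟨by rintro rfl; exact hd.1 h, Or.inl h⟩
            · exact ⟨by rintro rfl; exact hc h, Or.inr (Or.inr h)⟩
          · tauto
        · ext x
          simp only [Finset.mem_union, Finset.mem_sdiff, Finset.mem_insert]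
          tauto
      · rw [Finset.disjoint_left]
        intro x hx hx'
        rw [Finset.mem_sdiff] at hx'
        rcases Finset.mem_union.1 hx with h | h
        · rcases Finset.mem_insert.1 hx'.1 with rfl | h'
          · exact hd.1 h
          · exact Finset.disjoint_left.1 hd.2 h h'
        · exact hx'.2 h

lemma star (k : ℕ) (M : Finset ℤ) (c : ℤ) (hc : c ∈ M) :
    g M (k + 1) = g (M.erase c) (k + 1) + g (M ∪ N {c}) k := star_of k (B_eq k) M c hc

lemma g_interval (k : ℕ) : ∀ (m : ℕ) (a : ℤ),
    g (Finset.Icc a (a + m)) k = Nat.choose (2 * k + m - 1) k := by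
  induction k with
  | zero => intro m a; simp [g_zero]
  | succ k ih =>
    intro m
    induction m with
    | zero =>
      intro a
      rw [star k _ a (by simp)]
      have h1 : (Finset.Icc a (a + ((0 : ℕ) : ℤ))).erase a = ∅ := by
        ext x; simp
      have h2 : Finset.Icc a (a + ((0 : ℕ) : ℤ)) ∪ N {a}
          = Finset.Icc (a - 1) ((a - 1) + ((2 : ℕ) : ℤ)) := by
        ext x
        simp only [N, Finset.singleton_biUnion, Finset.mem_union, Finset.mem_Icc]
        omega
      rw [h1, h2, g_empty, ih, zero_add]
      have e1 : 2 * k + 2 - 1 = 2 * k + 1 := by omega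
      have e2 : 2 * (k + 1) + 0 - 1 = 2 * k + 1 := by omega
      rw [e1, e2, Nat.choose_symm_half]
    | succ m ihm =>
      intro a
      rw [star k _ (a + ((m + 1 : ℕ) : ℤ)) (by simp only [Finset.mem_Icc]; omega)]
      have h1 : (Finset.Icc a (a + ((m + 1 : ℕ) : ℤ))).erase (a + ((m + 1 : ℕ) : ℤ))
          = Finset.Icc a (a + (m : ℤ)) := by
        ext x
        simp only [Finset.mem_erase, Finset.mem_Icc]
        omega
      have h2 : Finset.Icc a (a + ((m + 1 : ℕ) : ℤ)) ∪ N {a + ((m + 1 : ℕ) : ℤ)}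
          = Finset.Icc a (a + ((m + 2 : ℕ) : ℤ)) := by
        ext x
        simp only [N, Finset.singleton_biUnion, Finset.mem_union, Finset.mem_Icc]
        omega
      rw [h1, h2, ihm, ih]
      have e1 : 2 * (k + 1) + m - 1 = 2 * k + m + 1 := by omega
      have e2 : 2 * k + (m + 2) - 1 = 2 * k + m + 1 := by omega
      have e3 : 2 * (k + 1) + (m + 1) - 1 = 2 * k + m + 1 + 1 := by omega
      rw [e1, e2, e3, Nat.choose_succ_succ' (2 * k + m + 1) k, add_comm]

/-- the base -/
def base (b : ℕ) : Finset ℤ := (Finset.range b).image (fun i : ℕ => 2 * (i : ℤ))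

lemma mem_base {b : ℕ} {x : ℤ} : x ∈ base b ↔ ∃ i : ℕ, i < b ∧ x = 2 * (i : ℤ) := by
  simp [base, eq_comm]

lemma card_base (b : ℕ) : (base b).card = b := by
  rw [base, Finset.card_image_of_injective, Finset.card_range]
  intro i j h
  simpa using h

lemma ind_base (b : ℕ) : Ind (base b) := by
  intro x hx x' hx' hne
  obtain ⟨i, -, rfl⟩ := mem_base.1 hx
  obtain ⟨j, -, rfl⟩ := mem_base.1 hx'
  rw [le_abs]
  omega

lemma N_base {b : ℕ} (hb : 2 ≤ b) (x : ℤ) :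
    x ∈ N (base b) ∧ 1 ≤ x ↔ x ∈ Finset.Icc (1 : ℤ) (1 + ((2 * b - 2 : ℕ) : ℤ)) := by
  rw [mem_N, Finset.mem_Icc]
  constructor
  · rintro ⟨⟨x', hx', h⟩, h1⟩
    obtain ⟨i, hi, rfl⟩ := mem_base.1 hx'
    rw [abs_le] at h
    omega
  · rintro ⟨h1, h2⟩
    refine ⟨⟨2 * ((x / 2).toNat : ℤ), mem_base.2 ⟨_, by omega, rfl⟩, ?_⟩, h1⟩
    rw [abs_le]
    omega

lemma tower_iff {n b : ℕ} (hb : 2 ≤ b) (hbn : b ≤ n) (T : Finset (ℤ × ℕ)) :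
    (IsDominoTower n b (cons (base b) T) ∧ ∀ x : ℤ, (x, 1) ∈ cons (base b) T → 1 ≤ x) ↔
      Tw (Finset.Icc (1 : ℤ) (1 + ((2 * b - 2 : ℕ) : ℤ))) (n - b) T := by
  have hg := good_cons (base b) T
  have hc := card_cons (base b) T
  rw [card_base] at hc
  have h1 : ∀ x : ℤ, (x, 1) ∈ cons (base b) T ↔ (x, 0) ∈ T := fun x => mem_cons1 (y := 0)
  simp only [h1]
  constructor
  · rintro ⟨⟨a1, -, a3⟩, a4⟩
    obtain ⟨-, b2, b3⟩ := hg.1 a3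
    exact ⟨by omega, fun x hx => (N_base hb x).1 ⟨b2 x hx, a4 x hx⟩, b3⟩
  · rintro ⟨a1, a2, a3⟩
    exact ⟨⟨by omega, fun x => mem_cons0.trans mem_base,
      hg.2 ⟨ind_base b, fun x hx => ((N_base hb x).2 (a2 x hx)).1, a3⟩⟩,
      fun x hx => ((N_base hb x).2 (a2 x hx)).2⟩

lemma row_tower {n b : ℕ} {T : Finset (ℤ × ℕ)} (h : IsDominoTower n b T) :
    cons (base b) (up T) = T := by
  have : row T = base b := by
    ext x
    rw [mem_row, h.2.1, mem_base]
  rw [← this, cons_row_up]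

noncomputable def towerEquiv {n b : ℕ} (hb : 2 ≤ b) (hbn : b ≤ n) :
    {T : Finset (ℤ × ℕ) // IsDominoTower n b T ∧ ∀ x : ℤ, (x, 1) ∈ T → 1 ≤ x} ≃
      {T // Tw (Finset.Icc (1 : ℤ) (1 + ((2 * b - 2 : ℕ) : ℤ))) (n - b) T} where
  toFun T := ⟨up T.1, (tower_iff hb hbn _).1 (by rw [row_tower T.2.1]; exact T.2)⟩
  invFun T := ⟨cons (base b) T.1, (tower_iff hb hbn _).2 T.2⟩
  left_inv T := Subtype.ext (row_tower T.2.1)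
  right_inv T := Subtype.ext (up_cons _ _)

end DT

theorem domino_tower_count_A (n b : ℕ) (hb : 2 ≤ b) (hbn : b ≤ n) :
    Nat.card {T : Finset (ℤ × ℕ) //
        IsDominoTower n b T ∧ ∀ x : ℤ, (x, 1) ∈ T → 1 ≤ x} =
      Nat.choose (2 * n - 3) (n - b) := by
  rw [Nat.card_congr (DT.towerEquiv hb hbn)]
  have h := DT.g_interval (n - b) (2 * b - 2) 1
  rw [DT.g] at h
  rw [h]
  congr 1
  omega
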